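/- arXiv:2202.02507 — 2 statements merged into one kernel-verified Lean document; each statement's English description precedes it below -/
import Mathlib

section
/- (Lemma 3, first sequence) For each integer j ≥ 1 set μ_j = k₂ 2^{−j}/(d − 2^{−j}). Then μ_j > 0 for all j, the sequence {μ_j} is decreasing and converges to 0, and the unique solution z_{μ_j} of μ_j z + h(z) = 0 equals d − 2^{−j} = k₂ d/(k₂ + μ_j). -/
open Real Filter Set

/-- x-coordinate of the intersection of the lines y = k*x and y = -k₂/2 + k₁(x+1/2). -/
noncomputable def xstar (k1 k2 ks : ℝ) : ℝ := (k1 - k2) / (2 * (ks - k1))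

/-- y-coordinate: y* = k* x*. -/
noncomputable def ystar (k1 k2 ks : ℝ) : ℝ := ks * xstar k1 k2 ks

/-- The slope k⁺ = (y* + k₂)/(x* + 1). -/
noncomputable def kplus (k1 k2 ks : ℝ) : ℝ :=
  (ystar k1 k2 ks + k2) / (xstar k1 k2 ks + 1)

/-- The function ψ: equal to k₂x outside (-1, -1/2), and the min of the two lines inside. -/
noncomputable def psi (k1 k2 ks : ℝ) (x : ℝ) : ℝ :=
  if x ∈ Set.Ioo (-1 : ℝ) (-(1 / 2) : ℝ) then
    min (-k2 + kplus k1 k2 ks * (x + 1)) (-k2 / 2 + k1 * (x + 1 / 2))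
  else k2 * x

/-- The rescaled functions ψ_j(x) = 2^(-j) ψ(2^j x). -/
noncomputable def psij (k1 k2 ks : ℝ) (j : ℕ) (x : ℝ) : ℝ :=
  (2 : ℝ) ^ (-(j : ℤ)) * psi k1 k2 ks ((2 : ℝ) ^ j * x)

/-- η(x) = sup_{j ≥ 1} ψ_j(x). -/
noncomputable def eta (k1 k2 ks : ℝ) (x : ℝ) : ℝ :=
  ⨆ j : {j : ℕ // 1 ≤ j}, psij k1 k2 ks j x

/-- h(x) = η(x - d). -/
noncomputable def hfun (k1 k2 ks d : ℝ) (x : ℝ) : ℝ := eta k1 k2 ks (x - d)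

/-- f(x) = k₀ (x - d). -/
noncomputable def ffun (k0 d : ℝ) (x : ℝ) : ℝ := k0 * (x - d)

/-- g(x) = f(-x) - h(-x). -/
noncomputable def gfun (k0 k1 k2 ks d : ℝ) (x : ℝ) : ℝ :=
  ffun k0 d (-x) - hfun k1 k2 ks d (-x)

theorem xstar_mem_Ioo {k1 k2 ks : ℝ} (hk12 : k1 < k2) (hks1 : (k1 + k2) / 2 < ks) :
    xstar k1 k2 ks ∈ Set.Ioo (-1 : ℝ) 0 := by
  have hpos : 0 < 2 * (ks - k1) := by linarith
  unfold xstar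
  exact ⟨by rw [lt_div_iff₀ hpos]; linarith, div_neg_of_neg_of_pos (by linarith) hpos⟩

theorem le_kplus {k1 k2 ks : ℝ} (hk12 : k1 < k2) (hks1 : (k1 + k2) / 2 < ks) (hks2 : ks < k2) :
    k2 ≤ kplus k1 k2 ks := by
  obtain ⟨hx, hx'⟩ := xstar_mem_Ioo hk12 hks1
  rw [kplus, ystar, le_div_iff₀ (by linarith)]
  nlinarith

/-- `ψ` grows at rate at least `k₁`. -/
theorem psi_add_mul_le {k1 k2 ks : ℝ} (hk12 : k1 < k2) (hp : k2 ≤ kplus k1 k2 ks)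
    {x y : ℝ} (hxy : x ≤ y) :
    psi k1 k2 ks x + k1 * (y - x) ≤ psi k1 k2 ks y := by
  unfold psi
  split_ifs with hx hy hy
  · apply le_min
    · have := min_le_left (-k2 + kplus k1 k2 ks * (x + 1)) (-k2 / 2 + k1 * (x + 1 / 2))
      nlinarith
    · have := min_le_right (-k2 + kplus k1 k2 ks * (x + 1)) (-k2 / 2 + k1 * (x + 1 / 2))
      linarith
  · have hy' : -(1 / 2) ≤ y := by
      by_contra! h
      exact hy ⟨hx.1.trans_le hxy, h⟩
    have := min_le_right (-k2 + kplus k1 k2 ks * (x + 1)) (-k2 / 2 + k1 * (x + 1 / 2))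
    nlinarith
  · have hx' : x ≤ -1 := by
      by_contra! h
      exact hx ⟨h, hxy.trans_lt hy.2⟩
    apply le_min
    · nlinarith [hy.1]
    · nlinarith
  · nlinarith

theorem psi_le_mul_abs {k1 k2 ks : ℝ} (hk1 : 0 < k1) (hk12 : k1 < k2) (x : ℝ) :
    psi k1 k2 ks x ≤ k2 * |x| := by
  unfold psi
  split_ifs with hx
  · refine (min_le_right _ _).trans ?_
    nlinarith [hx.2, abs_nonneg x]
  · exact mul_le_mul_of_nonneg_left (le_abs_self x) (by linarith)

theorem psij_add_mul_le {k1 k2 ks : ℝ} (hk12 : k1 < k2) (hp : k2 ≤ kplus k1 k2 ks)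
    (j : ℕ) {x y : ℝ} (hxy : x ≤ y) :
    psij k1 k2 ks j x + k1 * (y - x) ≤ psij k1 k2 ks j y := by
  have hj : (0 : ℝ) < 2 ^ j := by positivity
  have h := psi_add_mul_le hk12 hp (mul_le_mul_of_nonneg_left hxy hj.le)
  simp only [psij, zpow_neg, zpow_natCast]
  calc _ = ((2 : ℝ) ^ j)⁻¹ *
        (psi k1 k2 ks (2 ^ j * x) + k1 * (2 ^ j * y - 2 ^ j * x)) := by field_simp
    _ ≤ _ := mul_le_mul_of_nonneg_left h (by positivity)

theorem bddAbove_range_psij {k1 k2 ks : ℝ} (hk1 : 0 < k1) (hk12 : k1 < k2) (x : ℝ) :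
    BddAbove (Set.range fun j : {j : ℕ // 1 ≤ j} => psij k1 k2 ks j x) := by
  refine ⟨k2 * |x|, ?_⟩
  rintro _ ⟨⟨j, -⟩, rfl⟩
  have hj : (0 : ℝ) < 2 ^ j := by positivity
  simp only [psij, zpow_neg, zpow_natCast]
  calc _ ≤ ((2 : ℝ) ^ j)⁻¹ * (k2 * |2 ^ j * x|) :=
        mul_le_mul_of_nonneg_left (psi_le_mul_abs hk1 hk12 _) (by positivity)
    _ = _ := by rw [abs_mul, abs_of_pos hj]; field_simp

theorem strictMono_eta {k1 k2 ks : ℝ} (hk1 : 0 < k1) (hk12 : k1 < k2)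
    (hp : k2 ≤ kplus k1 k2 ks) : StrictMono (eta k1 k2 ks) := by
  intro x y hxy
  have : Nonempty {j : ℕ // 1 ≤ j} := ⟨⟨1, le_rfl⟩⟩
  have h : eta k1 k2 ks x ≤ eta k1 k2 ks y - k1 * (y - x) := by
    refine ciSup_le fun j => ?_
    have h1 := psij_add_mul_le hk12 hp j hxy.le
    have h2 : psij k1 k2 ks j y ≤ eta k1 k2 ks y :=
      le_ciSup (bddAbove_range_psij hk1 hk12 y) j
    linarith
  have := mul_pos hk1 (sub_pos.2 hxy)
  linarith

/-- No dyadic point `-2⁻ⁱ` is moved by rescaling into the interval where `ψ` is not linear. -/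
theorem psij_neg_zpow (k1 k2 ks : ℝ) (i j : ℕ) :
    psij k1 k2 ks j (-(2 : ℝ) ^ (-(i : ℤ))) = k2 * -(2 : ℝ) ^ (-(i : ℤ)) := by
  have hmul : (2 : ℝ) ^ j * -(2 : ℝ) ^ (-(i : ℤ)) = -(2 : ℝ) ^ ((j : ℤ) - i) := by
    rw [sub_eq_add_neg, zpow_add₀ two_ne_zero, zpow_natCast, mul_neg]
  have hout : (2 : ℝ) ^ j * -(2 : ℝ) ^ (-(i : ℤ)) ∉ Set.Ioo (-1 : ℝ) (-(1 / 2)) := by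
    rw [hmul]
    rintro ⟨h1, h2⟩
    have h1' : (2 : ℝ) ^ ((j : ℤ) - i) < 2 ^ (0 : ℤ) := by rw [zpow_zero]; linarith
    have h2' : (2 : ℝ) ^ (-1 : ℤ) < 2 ^ ((j : ℤ) - i) := by rw [zpow_neg_one]; linarith
    rw [zpow_lt_zpow_iff_right₀ one_lt_two] at h1' h2'
    omega
  rw [psij, psi, if_neg hout, zpow_neg _ (j : ℤ), zpow_natCast]
  field_simp

theorem eta_neg_zpow (k1 k2 ks : ℝ) (i : ℕ) :
    eta k1 k2 ks (-(2 : ℝ) ^ (-(i : ℤ))) = k2 * -(2 : ℝ) ^ (-(i : ℤ)) := by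
  have : Nonempty {j : ℕ // 1 ≤ j} := ⟨⟨1, le_rfl⟩⟩
  simp only [eta, psij_neg_zpow, ciSup_const]

theorem two_zpow_neg_lt_one {j : ℕ} (hj : 1 ≤ j) : (2 : ℝ) ^ (-(j : ℤ)) < 1 :=
  zpow_lt_one_of_neg₀ one_lt_two (by omega)

theorem tendsto_two_zpow_neg :
    Filter.Tendsto (fun j : ℕ => (2 : ℝ) ^ (-(j : ℤ))) Filter.atTop (nhds 0) := by
  simp only [zpow_neg, zpow_natCast, ← inv_pow]
  exact tendsto_pow_atTop_nhds_zero_of_lt_one (by norm_num) (by norm_num)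

/-- Lemma 3, first sequence: μ_j = k₂2^{−j}/(d − 2^{−j}) is positive,
decreasing, tends to 0, and the unique solution of μ_j z + h(z) = 0 is
d − 2^{−j} = k₂d/(k₂ + μ_j). -/
theorem stmt_8 (k1 k2 ks d : ℝ) (hk1 : 0 < k1) (hk12 : k1 < k2)
    (hks1 : (k1 + k2) / 2 < ks) (hks2 : ks < k2) (hd : 1 ≤ d)
    (μ : ℕ → ℝ)
    (hμ : ∀ j : ℕ, μ j = k2 * (2 : ℝ) ^ (-(j : ℤ)) / (d - (2 : ℝ) ^ (-(j : ℤ)))) :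
    (∀ j : ℕ, 1 ≤ j → 0 < μ j) ∧
    (∀ j : ℕ, 1 ≤ j → μ (j + 1) < μ j) ∧
    Filter.Tendsto μ Filter.atTop (nhds 0) ∧
    (∀ j : ℕ, 1 ≤ j →
      (μ j * (d - (2 : ℝ) ^ (-(j : ℤ))) + hfun k1 k2 ks d (d - (2 : ℝ) ^ (-(j : ℤ))) = 0) ∧
      (∀ z : ℝ, μ j * z + hfun k1 k2 ks d z = 0 → z = d - (2 : ℝ) ^ (-(j : ℤ))) ∧
      d - (2 : ℝ) ^ (-(j : ℤ)) = k2 * d / (k2 + μ j)) := by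
  have hk2 : 0 < k2 := hk1.trans hk12
  have ht (j : ℕ) : (0 : ℝ) < 2 ^ (-(j : ℤ)) := by positivity
  have hdt {j : ℕ} (hj : 1 ≤ j) : 0 < d - (2 : ℝ) ^ (-(j : ℤ)) := by
    linarith [two_zpow_neg_lt_one hj]
  have hpos (j : ℕ) (hj : 1 ≤ j) : 0 < μ j := by
    rw [hμ]
    exact div_pos (mul_pos hk2 (ht j)) (hdt hj)
  refine ⟨hpos, fun j hj => ?_, ?_, fun j hj => ?_⟩
  · have hlt : (2 : ℝ) ^ (-((j + 1 : ℕ) : ℤ)) < 2 ^ (-(j : ℤ)) :=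
      zpow_lt_zpow_right₀ one_lt_two (by push_cast; omega)
    rw [hμ, hμ]
    exact div_lt_div₀ (mul_lt_mul_of_pos_left hlt hk2) (by linarith)
      (mul_pos hk2 (ht j)).le (hdt hj)
  · rw [funext hμ]
    have h := (tendsto_two_zpow_neg.const_mul k2).div (tendsto_two_zpow_neg.const_sub d)
      (by linarith : d - 0 ≠ 0)
    rw [mul_zero, zero_div] at h
    exact h
  · have hsol : μ j * (d - (2 : ℝ) ^ (-(j : ℤ))) +
        hfun k1 k2 ks d (d - (2 : ℝ) ^ (-(j : ℤ))) = 0 := by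
      rw [hfun, sub_sub_cancel_left, eta_neg_zpow, hμ, div_mul_cancel₀ _ (hdt hj).ne']
      ring
    have hmono : StrictMono fun z => μ j * z + hfun k1 k2 ks d z := fun x y hxy =>
      add_lt_add (mul_lt_mul_of_pos_left hxy (hpos j hj))
        (strictMono_eta hk1 hk12 (le_kplus hk12 hks1 hks2) (sub_lt_sub_right hxy d))
    refine ⟨hsol, fun z hz => hmono.injective (hz.trans hsol.symm), ?_⟩
    rw [eq_div_iff (by linarith [hpos j hj]), mul_add, hμ, mul_div_cancel₀ _ (hdt hj).ne']
    ring
end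

section
/- (Lemma 3, second sequence) For each integer j ≥ 1 set ν_j = 2^{−j}|y*|/(d − 2^{−j}|x*|). Then ν_j > 0 for all j, the sequence {ν_j} is decreasing and converges to 0, and the unique solution z_{ν_j} of ν_j z + h(z) = 0 equals d + 2^{−j} x* = k* d/(k* + ν_j). -/
open Real Filter Set

theorem xstar_mem {k1 k2 ks : ℝ} (hks1 : (k1 + k2) / 2 < ks) (hks2 : ks < k2) :
    -1 < xstar k1 k2 ks ∧ xstar k1 k2 ks < -(1 / 2) := by
  have h : 0 < 2 * (ks - k1) := by linarith
  unfold xstar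
  constructor
  · rw [lt_div_iff₀ h]; linarith
  · rw [div_lt_iff₀ h]; linarith

theorem xstar_mul {k1 k2 ks : ℝ} (hks1 : (k1 + k2) / 2 < ks) (hks2 : ks < k2) :
    (ks - k1) * xstar k1 k2 ks = (k1 - k2) / 2 := by
  have h : ks - k1 ≠ 0 := by linarith
  unfold xstar
  field_simp

theorem kplus_mul {k1 k2 ks : ℝ} (hks1 : (k1 + k2) / 2 < ks) (hks2 : ks < k2) :
    kplus k1 k2 ks * (xstar k1 k2 ks + 1) = ks * xstar k1 k2 ks + k2 := by
  have h : xstar k1 k2 ks + 1 ≠ 0 := by linarith [(xstar_mem hks1 hks2).1]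
  unfold kplus ystar
  field_simp

theorem lt_kplus {k1 k2 ks : ℝ} (hks1 : (k1 + k2) / 2 < ks) (hks2 : ks < k2) :
    k2 < kplus k1 k2 ks := by
  obtain ⟨h1, h2⟩ := xstar_mem hks1 hks2
  have h : 0 < xstar k1 k2 ks + 1 := by linarith
  unfold kplus ystar
  rw [lt_div_iff₀ h]
  nlinarith

/-- A global max-min formula for `psi`. -/
theorem psi_eq_max {k1 k2 ks : ℝ} (hks1 : (k1 + k2) / 2 < ks) (hks2 : ks < k2)
    (x : ℝ) : psi k1 k2 ks x =
      max (k2 * x) (min (-k2 + kplus k1 k2 ks * (x + 1)) (-k2 / 2 + k1 * (x + 1 / 2))) := by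
  have hkp := lt_kplus hks1 hks2
  unfold psi
  split_ifs with hx
  · obtain ⟨h1, h2⟩ := hx
    refine (max_eq_right (le_min ?_ ?_)).symm <;> nlinarith
  · refine (max_eq_left ?_).symm
    rcases le_or_gt x (-1) with h | h
    · exact (min_le_left _ _).trans (by nlinarith)
    · have h2 : -(1 / 2) ≤ x := not_lt.1 fun h2 => hx ⟨h, h2⟩
      exact (min_le_right _ _).trans (by nlinarith)

theorem psi_add_le {k1 k2 ks : ℝ} (hks1 : (k1 + k2) / 2 < ks) (hks2 : ks < k2)
    {x y : ℝ} (hxy : x ≤ y) : psi k1 k2 ks x + k1 * (y - x) ≤ psi k1 k2 ks y := by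
  have hkp := lt_kplus hks1 hks2
  rw [psi_eq_max hks1 hks2, psi_eq_max hks1 hks2, ← max_add_add_right,
    ← min_add_add_right]
  refine max_le_max ?_ (min_le_min ?_ ?_) <;> nlinarith

theorem psi_le_of_nonpos {k1 k2 ks : ℝ} (hks1 : (k1 + k2) / 2 < ks)
    (hks2 : ks < k2) {x : ℝ} (hx : x ≤ 0) : psi k1 k2 ks x ≤ ks * x := by
  have hkp := lt_kplus hks1 hks2
  have h1 := xstar_mul hks1 hks2
  have h2 := kplus_mul hks1 hks2
  rw [psi_eq_max hks1 hks2]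
  refine max_le (by nlinarith) ?_
  rcases le_total x (xstar k1 k2 ks) with h | h
  · exact (min_le_left _ _).trans (by nlinarith)
  · exact (min_le_right _ _).trans (by nlinarith)

theorem psi_xstar {k1 k2 ks : ℝ} (hks1 : (k1 + k2) / 2 < ks) (hks2 : ks < k2) :
    psi k1 k2 ks (xstar k1 k2 ks) = ks * xstar k1 k2 ks := by
  have h1 := xstar_mul hks1 hks2
  have h2 := kplus_mul hks1 hks2
  unfold psi
  rw [if_pos (mem_Ioo.2 (xstar_mem hks1 hks2)),
    show -k2 + kplus k1 k2 ks * (xstar k1 k2 ks + 1) = ks * xstar k1 k2 ks by linarith,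
    show -k2 / 2 + k1 * (xstar k1 k2 ks + 1 / 2) = ks * xstar k1 k2 ks by linarith, min_self]

theorem two_zpow_mul_pow (j : ℕ) : (2 : ℝ) ^ (-(j : ℤ)) * 2 ^ j = 1 := by
  rw [zpow_neg, zpow_natCast]
  exact inv_mul_cancel₀ (by positivity)

theorem psij_add_le {k1 k2 ks : ℝ} (hks1 : (k1 + k2) / 2 < ks) (hks2 : ks < k2)
    (j : ℕ) {x y : ℝ} (hxy : x ≤ y) :
    psij k1 k2 ks j x + k1 * (y - x) ≤ psij k1 k2 ks j y := by
  have h := psi_add_le hks1 hks2 (mul_le_mul_of_nonneg_left hxy (pow_nonneg zero_le_two j))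
  unfold psij
  calc _ = (2 : ℝ) ^ (-(j : ℤ)) *
        (psi k1 k2 ks (2 ^ j * x) + k1 * (2 ^ j * y - 2 ^ j * x)) := by
        linear_combination (-(k1 * (y - x))) * two_zpow_mul_pow j
    _ ≤ _ := by gcongr

theorem psij_le_of_nonpos {k1 k2 ks : ℝ} (hks1 : (k1 + k2) / 2 < ks)
    (hks2 : ks < k2) (j : ℕ) {x : ℝ} (hx : x ≤ 0) : psij k1 k2 ks j x ≤ ks * x := by
  have h := psi_le_of_nonpos hks1 hks2
    (mul_nonpos_of_nonneg_of_nonpos (pow_nonneg (zero_le_two (α := ℝ)) j) hx)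
  unfold psij
  calc _ ≤ (2 : ℝ) ^ (-(j : ℤ)) * (ks * (2 ^ j * x)) := by gcongr
    _ = _ := by linear_combination (ks * x) * two_zpow_mul_pow j

theorem bddAbove_psij {k1 k2 ks : ℝ} (hks1 : (k1 + k2) / 2 < ks)
    (hks2 : ks < k2) (x : ℝ) :
    BddAbove (range fun j : {j : ℕ // 1 ≤ j} => psij k1 k2 ks j x) := by
  rcases le_total x 0 with hx | hx
  · exact ⟨ks * x, forall_mem_range.2 fun j => psij_le_of_nonpos hks1 hks2 j hx⟩
  · refine ⟨k2 * x, forall_mem_range.2 fun j => le_of_eq ?_⟩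
    have h : ¬ (2 : ℝ) ^ (j : ℕ) * x ∈ Ioo (-1 : ℝ) (-(1 / 2)) := fun h => by
      have : 0 ≤ (2 : ℝ) ^ (j : ℕ) * x := by positivity
      linarith [h.2]
    simp only [psij, psi, if_neg h]
    linear_combination (k2 * x) * two_zpow_mul_pow j

theorem eta_add_le {k1 k2 ks : ℝ} (hks1 : (k1 + k2) / 2 < ks) (hks2 : ks < k2)
    {x y : ℝ} (hxy : x ≤ y) : eta k1 k2 ks x + k1 * (y - x) ≤ eta k1 k2 ks y := by
  have : Nonempty {j : ℕ // 1 ≤ j} := ⟨⟨1, le_rfl⟩⟩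
  rw [← le_sub_iff_add_le]
  refine ciSup_le fun j => ?_
  rw [le_sub_iff_add_le]
  exact (psij_add_le hks1 hks2 j hxy).trans (le_ciSup (bddAbove_psij hks1 hks2 y) j)

theorem eta_two_zpow_mul_xstar {k1 k2 ks : ℝ} (hks1 : (k1 + k2) / 2 < ks)
    (hks2 : ks < k2) {j : ℕ} (hj : 1 ≤ j) :
    eta k1 k2 ks (2 ^ (-(j : ℤ)) * xstar k1 k2 ks) =
      ks * (2 ^ (-(j : ℤ)) * xstar k1 k2 ks) := by
  have : Nonempty {j : ℕ // 1 ≤ j} := ⟨⟨1, le_rfl⟩⟩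
  have hx : xstar k1 k2 ks ≤ 0 := by linarith [(xstar_mem hks1 hks2).2]
  have hx' : (2 : ℝ) ^ (-(j : ℤ)) * xstar k1 k2 ks ≤ 0 :=
    mul_nonpos_of_nonneg_of_nonpos (by positivity) hx
  refine le_antisymm (ciSup_le fun i => psij_le_of_nonpos hks1 hks2 i hx') ?_
  refine le_trans (le_of_eq ?_) (le_ciSup (bddAbove_psij hks1 hks2 _) ⟨j, hj⟩)
  have h : (2 : ℝ) ^ j * (2 ^ (-(j : ℤ)) * xstar k1 k2 ks) = xstar k1 k2 ks := by
    linear_combination xstar k1 k2 ks * two_zpow_mul_pow j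
  simp only [psij, h, psi_xstar hks1 hks2]
  ring

theorem strictMono_mul_add_hfun {k1 k2 ks : ℝ} (hk1 : 0 < k1)
    (hks1 : (k1 + k2) / 2 < ks) (hks2 : ks < k2) (d : ℝ) {c : ℝ} (hc : 0 ≤ c) :
    StrictMono fun z => c * z + hfun k1 k2 ks d z := by
  intro x y hxy
  have h := eta_add_le hks1 hks2 (sub_le_sub_right hxy.le d)
  simp only [hfun]
  nlinarith

/-- Lemma 3, second sequence: ν_j = 2^{−j}|y*|/(d − 2^{−j}|x*|) is positive,
decreasing, tends to 0, and the unique solution of ν_j z + h(z) = 0 is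
d + 2^{−j} x* = k*d/(k* + ν_j). -/
theorem stmt_9 (k1 k2 ks d : ℝ) (hk1 : 0 < k1) (hk12 : k1 < k2)
    (hks1 : (k1 + k2) / 2 < ks) (hks2 : ks < k2) (hd : 1 ≤ d)
    (ν : ℕ → ℝ)
    (hν : ∀ j : ℕ, ν j = (2 : ℝ) ^ (-(j : ℤ)) * |ystar k1 k2 ks| /
        (d - (2 : ℝ) ^ (-(j : ℤ)) * |xstar k1 k2 ks|)) :
    (∀ j : ℕ, 1 ≤ j → 0 < ν j) ∧
    (∀ j : ℕ, 1 ≤ j → ν (j + 1) < ν j) ∧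
    Filter.Tendsto ν Filter.atTop (nhds 0) ∧
    (∀ j : ℕ, 1 ≤ j →
      (ν j * (d + (2 : ℝ) ^ (-(j : ℤ)) * xstar k1 k2 ks)
          + hfun k1 k2 ks d (d + (2 : ℝ) ^ (-(j : ℤ)) * xstar k1 k2 ks) = 0) ∧
      (∀ z : ℝ, ν j * z + hfun k1 k2 ks d z = 0 →
          z = d + (2 : ℝ) ^ (-(j : ℤ)) * xstar k1 k2 ks) ∧
      d + (2 : ℝ) ^ (-(j : ℤ)) * xstar k1 k2 ks = ks * d / (ks + ν j)) := by
  obtain ⟨hx1, hx2⟩ := xstar_mem hks1 hks2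
  have hks : 0 < ks := by linarith
  have hyabs : |ystar k1 k2 ks| = -(ks * xstar k1 k2 ks) :=
    abs_of_neg (mul_neg_of_pos_of_neg hks (by linarith))
  have hxabs : |xstar k1 k2 ks| = -xstar k1 k2 ks := abs_of_neg (by linarith)
  rw [hyabs, hxabs] at hν
  have hη (j : ℕ) (hj : 1 ≤ j) := eta_two_zpow_mul_xstar hks1 hks2 hj
  set a := xstar k1 k2 ks
  have ht0 (j : ℕ) : (0 : ℝ) < 2 ^ (-(j : ℤ)) := by positivity
  have ht1 (j : ℕ) : (2 : ℝ) ^ (-(j : ℤ)) ≤ 1 :=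
    zpow_le_one_of_nonpos₀ one_le_two (by simp)
  have hden (j : ℕ) : 0 < d - 2 ^ (-(j : ℤ)) * -a := by nlinarith [ht0 j, ht1 j]
  have hνpos (j : ℕ) : 0 < ν j := by
    rw [hν]
    exact div_pos (mul_pos (ht0 j) (by nlinarith)) (hden j)
  have hνmul (j : ℕ) : ν j * (d + 2 ^ (-(j : ℤ)) * a) = -(ks * (2 ^ (-(j : ℤ)) * a)) := by
    have h := (eq_div_iff (hden j).ne').1 (hν j)
    linear_combination h
  refine ⟨fun j _ => hνpos j, fun j _ => ?_, ?_, fun j hj => ?_⟩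
  · have hlt : (2 : ℝ) ^ (-((j + 1 : ℕ) : ℤ)) < 2 ^ (-(j : ℤ)) :=
      zpow_lt_zpow_right₀ one_lt_two (by push_cast; linarith)
    rw [hν, hν]
    exact div_lt_div₀ (mul_lt_mul_of_pos_right hlt (by nlinarith)) (by nlinarith)
      (mul_pos (ht0 j) (by nlinarith)).le (hden j)
  · have ht : Tendsto (fun j : ℕ => (2 : ℝ) ^ (-(j : ℤ))) atTop (nhds 0) := by
      simpa [zpow_neg] using
        tendsto_pow_atTop_nhds_zero_of_lt_one (r := (2 : ℝ)⁻¹) (by norm_num) (by norm_num)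
    have h := (ht.mul_const (-(ks * a))).div ((ht.mul_const (-a)).const_sub d)
      (by rw [zero_mul, sub_zero]; linarith)
    rw [zero_mul, zero_div] at h
    exact h.congr fun j => (hν j).symm
  · have hsol : ν j * (d + 2 ^ (-(j : ℤ)) * a) +
        hfun k1 k2 ks d (d + 2 ^ (-(j : ℤ)) * a) = 0 := by
      rw [hfun, add_sub_cancel_left, hη j hj, hνmul]
      ring
    refine ⟨hsol, fun z hz => ?_, ?_⟩
    · exact (strictMono_mul_add_hfun hk1 hks1 hks2 d (hνpos j).le).injective
        (hz.trans hsol.symm)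
    · rw [eq_div_iff (add_pos hks (hνpos j)).ne']
      linear_combination hνmul j
end
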